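/- Exact KL for Gaussian low-rank updates: let π = N(m, C) with C nonsingular, μ = N(0, I_d), and for orthonormal U = [U_r, U_⊥], let π̃ be the Gaussian with mean U_r U_r^T m and covariance U · diag(U_r^T C U_r, I_{d−r}) · U^T. Then 2·D_KL(π || π̃) = ln det(U_r^T C U_r) − ln det C − (d − r) + trace(U_⊥^T C U_⊥) + ||U_⊥^T m||². -/

import Mathlib

open Matrix MeasureTheory

/-- The density of the Gaussian measure `N(m, C)` on `ℝ^d` with respect to Lebesgue measure. -/
noncomputable def gaussDensity (d : ℕ) (m : Fin d → ℝ) (C : Matrix (Fin d) (Fin d) ℝ)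
    (x : Fin d → ℝ) : ℝ :=
  (Real.sqrt ((2 * Real.pi) ^ d * C.det))⁻¹ *
    Real.exp (-(1 / 2) * ((x - m) ⬝ᵥ (C⁻¹ *ᵥ (x - m))))

open ProbabilityTheory in
/-- one-dimensional moments -/
lemma phi_integrable (k : ℕ) (_hk : k ≤ 2) :
    Integrable (fun x : ℝ => x ^ k * gaussianPDFReal 0 1 x) := by
  have h := integrable_rpow_mul_exp_neg_mul_sq (b := 1 / 2) (by norm_num) (s := k)
    (by have : (0:ℝ) ≤ k := by positivity
        linarith)
  have h2 := h.const_mul (Real.sqrt (2 * Real.pi))⁻¹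
  refine h2.congr (Filter.Eventually.of_forall fun x => ?_)
  simp only [gaussianPDFReal_def, Real.rpow_natCast]
  simp
  ring_nf

open ProbabilityTheory in
lemma phi_int0 : ∫ x : ℝ, gaussianPDFReal 0 1 x = 1 :=
  integral_gaussianPDFReal_eq_one 0 (by norm_num)

open ProbabilityTheory in
lemma phi_int1 : ∫ x : ℝ, x * gaussianPDFReal 0 1 x = 0 := by
  have h := integral_gaussianReal_eq_integral_smul (μ := 0) (v := 1) (f := fun x : ℝ => x)
    (by norm_num)
  rw [integral_id_gaussianReal] at h
  simp only [smul_eq_mul] at h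
  refine Eq.trans ?_ h.symm
  exact integral_congr_ae (Filter.Eventually.of_forall fun x => mul_comm _ _)

open ProbabilityTheory in
lemma phi_int2 : ∫ x : ℝ, x ^ 2 * gaussianPDFReal 0 1 x = 1 := by
  have h := integral_gaussianReal_eq_integral_smul (μ := 0) (v := 1) (f := fun x : ℝ => x ^ 2)
    (by norm_num)
  have h2 := variance_fun_id_gaussianReal (μ := 0) (v := 1)
  rw [variance_eq_integral measurable_id'.aemeasurable] at h2
  simp only [integral_id_gaussianReal, sub_zero] at h2
  rw [h] at h2
  simpa [mul_comm] using h2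

/-- standard Gaussian density as a product -/
noncomputable def stdG (d : ℕ) (y : Fin d → ℝ) : ℝ :=
  ∏ i, ProbabilityTheory.gaussianPDFReal 0 1 (y i)

lemma stdG_mon (d : ℕ) (e : Fin d → ℕ) (he : ∀ i, e i ≤ 2) :
    Integrable (fun y : Fin d → ℝ => (∏ i, y i ^ e i) * stdG d y) ∧
    ∫ y : Fin d → ℝ, (∏ i, y i ^ e i) * stdG d y
      = ∏ i, ∫ x : ℝ, x ^ e i * ProbabilityTheory.gaussianPDFReal 0 1 x := by
  simp only [stdG, ← Finset.prod_mul_distrib]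
  constructor
  · exact Integrable.fintype_prod
      (f := fun i (x : ℝ) => x ^ e i * ProbabilityTheory.gaussianPDFReal 0 1 x)
      (fun i => phi_integrable _ (he i))
  · exact integral_fintype_prod_volume_eq_prod
      (f := fun i (x : ℝ) => x ^ e i * ProbabilityTheory.gaussianPDFReal 0 1 x)

lemma stdG_0 (d : ℕ) : Integrable (stdG d) ∧ ∫ y, stdG d y = 1 := by
  have h := stdG_mon d (fun _ => 0) (by simp)
  simpa [phi_int0] using h

lemma stdG_1 (d : ℕ) (i : Fin d) : Integrable (fun y => y i * stdG d y) ∧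
    ∫ y : Fin d → ℝ, y i * stdG d y = 0 := by
  have h := stdG_mon d (fun k => if k = i then 1 else 0) (by intro k; split_ifs <;> simp)
  have e : ∀ y : Fin d → ℝ, ∏ k, y k ^ (if k = i then 1 else 0) = y i := by
    intro y; simp [pow_ite]
  simp only [e] at h
  refine ⟨h.1, h.2.trans ?_⟩
  exact Finset.prod_eq_zero (Finset.mem_univ i) (by simpa using phi_int1)

lemma stdG_2 (d : ℕ) (i j : Fin d) : Integrable (fun y => y i * y j * stdG d y) ∧
    ∫ y : Fin d → ℝ, y i * y j * stdG d y = if i = j then 1 else 0 := by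
  have h := stdG_mon d (fun k => (if k = i then 1 else 0) + (if k = j then 1 else 0))
    (by intro k; split_ifs <;> simp)
  have e : ∀ y : Fin d → ℝ,
      ∏ k, y k ^ ((if k = i then 1 else 0) + (if k = j then 1 else 0)) = y i * y j := by
    intro y; simp only [pow_add, Finset.prod_mul_distrib]; simp [pow_ite]
  simp only [e] at h
  refine ⟨h.1, h.2.trans ?_⟩
  split_ifs with hij
  · subst hij
    apply Finset.prod_eq_one
    intro k _
    by_cases hk : k = i
    · simpa [hk] using phi_int2
    · simpa [hk] using phi_int0
  · refine Finset.prod_eq_zero (Finset.mem_univ i) ?_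
    simpa [hij] using phi_int1

lemma stdG_quad (d : ℕ) (Q : Matrix (Fin d) (Fin d) ℝ) (b : Fin d → ℝ) (c : ℝ) :
    ∫ y : Fin d → ℝ, (y ⬝ᵥ (Q *ᵥ y) + b ⬝ᵥ y + c) * stdG d y = Q.trace + c := by
  have e : ∀ y : Fin d → ℝ, (y ⬝ᵥ (Q *ᵥ y) + b ⬝ᵥ y + c) * stdG d y =
      ((∑ i, ∑ j, Q i j * (y i * y j * stdG d y)) + ∑ i, b i * (y i * stdG d y))
        + c * stdG d y := by
    intro y
    simp only [dotProduct, mulVec, add_mul, Finset.sum_mul, Finset.mul_sum]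
    congr 1
    congr 1
    · refine Finset.sum_congr rfl fun i _ => Finset.sum_congr rfl fun j _ => by ring
    · refine Finset.sum_congr rfl fun i _ => by ring
  simp only [e]
  have h2 : ∀ i j : Fin d, Integrable (fun y => Q i j * (y i * y j * stdG d y)) :=
    fun i j => (stdG_2 d i j).1.const_mul _
  have h1 : ∀ i : Fin d, Integrable (fun y => b i * (y i * stdG d y)) :=
    fun i => (stdG_1 d i).1.const_mul _
  have h2s : Integrable (fun y : Fin d → ℝ => ∑ i, ∑ j, Q i j * (y i * y j * stdG d y)) :=
    integrable_finsetSum _ fun i _ => integrable_finsetSum _ fun j _ => h2 i j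
  have h1s : Integrable (fun y : Fin d → ℝ => ∑ i, b i * (y i * stdG d y)) :=
    integrable_finsetSum _ fun i _ => h1 i
  have h21 : Integrable (fun y : Fin d → ℝ => (∑ i, ∑ j, Q i j * (y i * y j * stdG d y))
      + ∑ i, b i * (y i * stdG d y)) := h2s.add h1s
  rw [integral_add h21 ((stdG_0 d).1.const_mul c), integral_add h2s h1s,
    integral_finsetSum _ (fun i _ => integrable_finsetSum _ fun j _ => h2 i j),
    integral_finsetSum _ (fun i _ => h1 i), integral_const_mul, (stdG_0 d).2]
  simp_rw [integral_finsetSum _ (fun j _ => h2 _ j), integral_const_mul, (stdG_1 d _).2,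
    (stdG_2 d _ _).2]
  simp [Matrix.trace]

lemma stdG_eq (d : ℕ) (y : Fin d → ℝ) :
    stdG d y = (Real.sqrt ((2 * Real.pi) ^ d))⁻¹ * Real.exp (-(1 / 2) * (y ⬝ᵥ y)) := by
  have h : Real.sqrt ((2 * Real.pi) ^ d) = (Real.sqrt (2 * Real.pi)) ^ d := by
    rw [Real.sqrt_eq_iff_mul_self_eq (by positivity) (by positivity), ← mul_pow,
      Real.mul_self_sqrt (by positivity)]
  simp only [stdG, ProbabilityTheory.gaussianPDFReal_def, h, Finset.prod_mul_distrib,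
    ← Real.exp_sum, dotProduct, Finset.mul_sum]
  congr 1
  · simp only [NNReal.coe_one, mul_one, Finset.prod_const, Finset.card_univ, Fintype.card_fin,
      inv_pow]
  · congr 1
    refine Finset.sum_congr rfl fun i _ => ?_
    simp only [NNReal.coe_one, mul_one, sub_zero]
    ring

lemma exists_factor (d : ℕ) (C : Matrix (Fin d) (Fin d) ℝ) (hC : C.PosDef) :
    ∃ A : Matrix (Fin d) (Fin d) ℝ, A.det ≠ 0 ∧ C = A * Aᵀ := by
  open scoped MatrixOrder Matrix.Norms.L2Operator in
  obtain ⟨B, hB⟩ := CStarAlgebra.nonneg_iff_eq_star_mul_self.mp hC.posSemidef.nonneg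
  have hB' : C = Bᵀ * B := by
    rw [hB, Matrix.star_eq_conjTranspose, conjTranspose_eq_transpose_of_trivial]
  refine ⟨Bᵀ, ?_, by simpa using hB'⟩
  have := hC.det_pos
  rw [hB', det_mul] at this
  intro h0
  rw [h0] at this
  simp at this

lemma quad_factor (d : ℕ) (A : Matrix (Fin d) (Fin d) ℝ) (hA : A.det ≠ 0) (y : Fin d → ℝ) :
    (A *ᵥ y) ⬝ᵥ ((A * Aᵀ)⁻¹ *ᵥ (A *ᵥ y)) = y ⬝ᵥ y := by
  have hu : IsUnit A.det := isUnit_iff_ne_zero.mpr hA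
  rw [Matrix.mul_inv_rev, mulVec_mulVec, Matrix.mul_assoc, nonsing_inv_mul _ hu, Matrix.mul_one, dotProduct_mulVec,
    ← mulVec_transpose, mulVec_mulVec, ← transpose_nonsing_inv, transpose_transpose,
    nonsing_inv_mul _ hu, one_mulVec]

lemma change_var (d : ℕ) (m : Fin d → ℝ) (A : Matrix (Fin d) (Fin d) ℝ) (hA : A.det ≠ 0)
    (g : (Fin d → ℝ) → ℝ) :
    ∫ x, g x * gaussDensity d m (A * Aᵀ) x = ∫ y, g (A *ᵥ y + m) * stdG d y := by
  rw [← integral_add_right_eq_self _ m]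
  have hmap := Real.map_matrix_volume_pi_eq_smul_volume_pi hA
  have hinj : Function.Injective (Matrix.toLin' A) := by
    have := mulVec_injective_of_isUnit ((isUnit_iff_isUnit_det A).2 (isUnit_iff_ne_zero.mpr hA))
    intro x y hxy
    exact this (by simpa using hxy)
  have hemb : MeasurableEmbedding (Matrix.toLin' A) :=
    (LinearMap.continuous_of_finiteDimensional (Matrix.toLin' A)).measurableEmbedding hinj
  have h := hemb.integral_map (μ := volume)
    (fun x => g (x + m) * gaussDensity d m (A * Aᵀ) (x + m))
  rw [hmap, integral_smul_measure, ENNReal.toReal_ofReal (abs_nonneg _)] at h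
  have hd : |A.det| ≠ 0 := abs_ne_zero.mpr hA
  have h' : ∫ x, g (x + m) * gaussDensity d m (A * Aᵀ) (x + m) =
      |A.det| * ∫ y, g (toLin' A y + m) * gaussDensity d m (A * Aᵀ) (toLin' A y + m) := by
    rw [← h, smul_eq_mul, abs_inv, mul_inv_cancel_left₀ hd]
  rw [h', ← integral_const_mul]
  congr 1
  ext y
  have hs : Real.sqrt ((2 * Real.pi) ^ d * (A * Aᵀ).det)
      = Real.sqrt ((2 * Real.pi) ^ d) * |A.det| := by
    rw [Real.sqrt_mul (by positivity), det_mul, det_transpose, Real.sqrt_mul_self_eq_abs]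
  rw [gaussDensity, stdG_eq, hs, toLin'_apply, add_sub_cancel_right, quad_factor d A hA]
  field_simp

lemma log_ratio (d : ℕ) (m n : Fin d → ℝ) (C K : Matrix (Fin d) (Fin d) ℝ)
    (hC : 0 < C.det) (hK : 0 < K.det) (x : Fin d → ℝ) :
    Real.log (gaussDensity d m C x / gaussDensity d n K x) =
      (1 / 2) * (Real.log K.det - Real.log C.det - (x - m) ⬝ᵥ (C⁻¹ *ᵥ (x - m))
        + (x - n) ⬝ᵥ (K⁻¹ *ᵥ (x - n))) := by
  have key : ∀ (n : Fin d → ℝ) (K : Matrix (Fin d) (Fin d) ℝ), 0 < K.det →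
      gaussDensity d n K x ≠ 0 ∧ Real.log (gaussDensity d n K x) =
      -(1 / 2) * (Real.log ((2 * Real.pi) ^ d) + Real.log K.det)
        - (1 / 2) * ((x - n) ⬝ᵥ (K⁻¹ *ᵥ (x - n))) := by
    intro n K hK
    have hp : 0 < (2 * Real.pi) ^ d * K.det := by positivity
    have hs : (Real.sqrt ((2 * Real.pi) ^ d * K.det))⁻¹ ≠ 0 :=
      inv_ne_zero (Real.sqrt_pos.mpr hp).ne'
    refine ⟨mul_ne_zero hs (Real.exp_pos _).ne', ?_⟩
    rw [gaussDensity, Real.log_mul hs (Real.exp_pos _).ne', Real.log_inv, Real.log_sqrt hp.le,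
      Real.log_exp, Real.log_mul (by positivity) hK.ne']
    ring
  rw [Real.log_div (key m C hC).1 (key n K hK).1, (key m C hC).2, (key n K hK).2]
  ring

lemma gauss_kl (d : ℕ) (m n : Fin d → ℝ) (C K : Matrix (Fin d) (Fin d) ℝ)
    (hC : C.PosDef) (hK : 0 < K.det) :
    2 * (∫ x : Fin d → ℝ, Real.log (gaussDensity d m C x / gaussDensity d n K x)
        * gaussDensity d m C x) =
      Real.log K.det - Real.log C.det - d + (K⁻¹ * C).trace
        + (m - n) ⬝ᵥ (K⁻¹ *ᵥ (m - n)) := by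
  have hCd := hC.det_pos
  simp only [log_ratio d m n C K hCd hK]
  obtain ⟨A, hA, rfl⟩ := exists_factor d C hC
  rw [change_var d m A hA (fun x => (1 / 2) * (Real.log K.det - Real.log (A * Aᵀ).det
    - (x - m) ⬝ᵥ ((A * Aᵀ)⁻¹ *ᵥ (x - m)) + (x - n) ⬝ᵥ (K⁻¹ *ᵥ (x - n))))]
  have hq := stdG_quad d ((1 / 2 : ℝ) • (Aᵀ * K⁻¹ * A - 1))
    ((1 / 2 : ℝ) • (Aᵀ *ᵥ (K⁻¹ *ᵥ (m - n)) + Aᵀ *ᵥ (K⁻¹ᵀ *ᵥ (m - n))))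
    ((1 / 2) * (Real.log K.det - Real.log (A * Aᵀ).det + (m - n) ⬝ᵥ (K⁻¹ *ᵥ (m - n))))
  have e : ∀ y : Fin d → ℝ, (1 / 2) * (Real.log K.det - Real.log (A * Aᵀ).det
      - (A *ᵥ y + m - m) ⬝ᵥ ((A * Aᵀ)⁻¹ *ᵥ (A *ᵥ y + m - m))
      + (A *ᵥ y + m - n) ⬝ᵥ (K⁻¹ *ᵥ (A *ᵥ y + m - n))) =
      y ⬝ᵥ (((1 / 2 : ℝ) • (Aᵀ * K⁻¹ * A - 1)) *ᵥ y)
      + ((1 / 2 : ℝ) • (Aᵀ *ᵥ (K⁻¹ *ᵥ (m - n)) + Aᵀ *ᵥ (K⁻¹ᵀ *ᵥ (m - n)))) ⬝ᵥ y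
      + ((1 / 2) * (Real.log K.det - Real.log (A * Aᵀ).det
        + (m - n) ⬝ᵥ (K⁻¹ *ᵥ (m - n)))) := by
    intro y
    rw [add_sub_cancel_right, quad_factor d A hA, add_sub_assoc]
    generalize m - n = w
    have t1 : ∀ (v z : Fin d → ℝ) (M : Matrix (Fin d) (Fin d) ℝ),
        (Mᵀ *ᵥ v) ⬝ᵥ z = v ⬝ᵥ (M *ᵥ z) := by
      intro v z M
      rw [dotProduct_mulVec, mulVec_transpose]
    have t2 : y ⬝ᵥ ((Aᵀ * K⁻¹ * A) *ᵥ y) = (A *ᵥ y) ⬝ᵥ (K⁻¹ *ᵥ (A *ᵥ y)) := by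
      rw [← mulVec_mulVec, ← mulVec_mulVec, dotProduct_comm, t1, dotProduct_comm]
    rw [smul_mulVec, dotProduct_smul, smul_dotProduct, sub_mulVec, one_mulVec, dotProduct_sub, t2,
      add_dotProduct, add_dotProduct, t1, t1, t1, mulVec_add, dotProduct_add, dotProduct_add,
      dotProduct_comm (K⁻¹ *ᵥ w)]
    simp only [smul_eq_mul]
    ring
  simp only [e]
  rw [hq, trace_smul, trace_sub, trace_one, Fintype.card_fin, Matrix.mul_assoc, trace_mul_comm Aᵀ,
    Matrix.mul_assoc]
  simp only [smul_eq_mul]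
  ring

/-- Exact KL divergence for Gaussian low-rank updates: with `π = N(m, C)` and `π̃` Gaussian
with mean `U_r U_rᵀ m` and covariance `U_r (U_rᵀ C U_r) U_rᵀ + U_⊥ U_⊥ᵀ`,
`2 D_KL(π‖π̃) = ln det(U_rᵀ C U_r) − ln det C − (d−r) + tr(U_⊥ᵀ C U_⊥) + ‖U_⊥ᵀ m‖²`. -/
theorem gaussian_lowrank_kl (d r : ℕ) (hr : r ≤ d)
    (m : Fin d → ℝ) (C : Matrix (Fin d) (Fin d) ℝ) (hC : C.PosDef)
    (Ur : Matrix (Fin d) (Fin r) ℝ) (Up : Matrix (Fin d) (Fin (d - r)) ℝ)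
    (hUr : Urᵀ * Ur = 1) (hUp : Upᵀ * Up = 1) (hortho : Urᵀ * Up = 0)
    (hcomplete : Ur * Urᵀ + Up * Upᵀ = 1) :
    2 * (∫ x : Fin d → ℝ,
        Real.log (gaussDensity d m C x /
          gaussDensity d (Ur *ᵥ (Urᵀ *ᵥ m)) (Ur * (Urᵀ * C * Ur) * Urᵀ + Up * Upᵀ) x)
        * gaussDensity d m C x)
      = Real.log (Urᵀ * C * Ur).det - Real.log C.det - ((d : ℝ) - r)
        + (Upᵀ * C * Up).trace + (Upᵀ *ᵥ m) ⬝ᵥ (Upᵀ *ᵥ m) := by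
  have hT : Upᵀ * Ur = 0 := by
    have := congrArg transpose hortho
    simpa using this
  have hS : (Urᵀ * C * Ur).PosDef := by
    have hinj : Function.Injective Ur.mulVec := by
      intro x y hxy
      have h2 := congrArg (fun v => Urᵀ *ᵥ v) hxy
      simpa [mulVec_mulVec, hUr] using h2
    have := hC.conjTranspose_mul_mul_same hinj
    rwa [conjTranspose_eq_transpose_of_trivial] at this
  set S := Urᵀ * C * Ur with hSdef
  have hSu : IsUnit S.det := isUnit_iff_ne_zero.mpr hS.det_pos.ne'
  have hdet : (Ur * S * Urᵀ + Up * Upᵀ).det = S.det := by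
    have h1 : Ur * S * Urᵀ + Up * Upᵀ = 1 + Ur * ((S - 1) * Urᵀ) := by
      rw [← hcomplete, Matrix.sub_mul, Matrix.mul_sub, Matrix.one_mul, Matrix.mul_assoc]
      abel
    rw [h1, det_one_add_mul_comm, Matrix.mul_assoc, hUr, Matrix.mul_one, add_sub_cancel]
  have hinv : (Ur * S * Urᵀ + Up * Upᵀ)⁻¹ = Ur * S⁻¹ * Urᵀ + Up * Upᵀ := by
    apply inv_eq_right_inv
    have a1 : Ur * S * Urᵀ * (Ur * S⁻¹ * Urᵀ) = Ur * Urᵀ := by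
      calc _ = Ur * ((S * (Urᵀ * Ur)) * S⁻¹) * Urᵀ := by simp only [Matrix.mul_assoc]
        _ = _ := by rw [hUr, Matrix.mul_one, mul_nonsing_inv _ hSu, Matrix.mul_one]
    have a2 : Ur * S * Urᵀ * (Up * Upᵀ) = 0 := by
      calc _ = Ur * S * (Urᵀ * Up) * Upᵀ := by simp only [Matrix.mul_assoc]
        _ = _ := by rw [hortho]; simp
    have a3 : Up * Upᵀ * (Ur * S⁻¹ * Urᵀ) = 0 := by
      calc _ = Up * (Upᵀ * Ur) * S⁻¹ * Urᵀ := by simp only [Matrix.mul_assoc]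
        _ = _ := by rw [hT]; simp
    have a4 : Up * Upᵀ * (Up * Upᵀ) = Up * Upᵀ := by
      calc _ = Up * (Upᵀ * Up) * Upᵀ := by simp only [Matrix.mul_assoc]
        _ = _ := by rw [hUp, Matrix.mul_one]
    rw [Matrix.add_mul, Matrix.mul_add, Matrix.mul_add, a1, a2, a3, a4, add_zero, zero_add, hcomplete]
  have hm : m - Ur *ᵥ (Urᵀ *ᵥ m) = Up *ᵥ (Upᵀ *ᵥ m) := by
    have h1 : (Ur * Urᵀ + Up * Upᵀ) *ᵥ m = m := by rw [hcomplete, one_mulVec]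
    rw [add_mulVec, ← mulVec_mulVec, ← mulVec_mulVec] at h1
    exact sub_eq_of_eq_add' h1.symm
  rw [gauss_kl d m _ C _ hC (by rw [hdet]; exact hS.det_pos), hdet, hinv, hm]
  have htr : ((Ur * S⁻¹ * Urᵀ + Up * Upᵀ) * C).trace = r + (Upᵀ * C * Up).trace := by
    rw [Matrix.add_mul, trace_add]
    congr 1
    · rw [Matrix.mul_assoc, Matrix.mul_assoc, trace_mul_comm, Matrix.mul_assoc, ← hSdef, nonsing_inv_mul _ hSu]
      simp
    · rw [Matrix.mul_assoc, trace_mul_comm]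
  have hv : (Ur * S⁻¹ * Urᵀ + Up * Upᵀ) *ᵥ (Up *ᵥ (Upᵀ *ᵥ m)) = Up *ᵥ (Upᵀ *ᵥ m) := by
    have b1 : (Ur * S⁻¹ * Urᵀ + Up * Upᵀ) * Up = Up := by
      rw [Matrix.add_mul, Matrix.mul_assoc, hortho, Matrix.mul_assoc Up, hUp]; simp
    rw [mulVec_mulVec, b1]
  have hd2 : (Up *ᵥ (Upᵀ *ᵥ m)) ⬝ᵥ (Up *ᵥ (Upᵀ *ᵥ m)) = (Upᵀ *ᵥ m) ⬝ᵥ (Upᵀ *ᵥ m) := by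
    rw [dotProduct_mulVec, ← mulVec_transpose, mulVec_mulVec, hUp, one_mulVec]
  rw [htr, hv, hd2]
  ring
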